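/- Let 𝕋 be a time scale, α ∈ ]0,1], and let f, g : 𝕋 → ℝ be continuous functions, both nabla fractional differentiable of order α at t ∈ 𝕋_κ, with g(ρ(t))·g(t) ≠ 0. Then the quotient f/g is nabla fractional differentiable of order α at t with (f/g)^{∇^α}(t) = (f^{∇^α}(t)·g(t) − f(t)·g^{∇^α}(t))/(g(ρ(t))·g(t)). -/

import Mathlib

open Set Filter Topology
open scoped Classical

/-- Backward jump operator ρ on a time scale `T`:
`ρ(t) = sup {s ∈ T | s < t}`, with `ρ(t) = t` when this set is empty. -/
noncomputable def TS.rho (T : Set ℝ) (t : ℝ) : ℝ :=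
  if ({s | s ∈ T ∧ s < t}).Nonempty then sSup {s | s ∈ T ∧ s < t} else t

/-- Forward jump operator σ on a time scale `T`:
`σ(t) = inf {s ∈ T | s > t}`, with `σ(t) = t` when this set is empty. -/
noncomputable def TS.sigma (T : Set ℝ) (t : ℝ) : ℝ :=
  if ({s | s ∈ T ∧ t < s}).Nonempty then sInf {s | s ∈ T ∧ t < s} else t

/-- `𝕋_κ`: remove the minimum of `T` when it exists and is right-scattered. -/
def TS.kappaLow (T : Set ℝ) : Set ℝ :=
  T \ {m | IsLeast T m ∧ m < TS.sigma T m}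

/-- `𝕋^κ`: remove the maximum of `T` when it exists and is left-scattered. -/
def TS.kappaHigh (T : Set ℝ) : Set ℝ :=
  T \ {M | IsGreatest T M ∧ TS.rho T M < M}

/-- Signed real power: `x^α = sign(x) * |x|^α`.  For `x ≥ 0` this is the usual
real power; for `x < 0` it is `-(-x)^α` (in particular, for `α = 1/q` with `q`
odd, the real `q`-th root). -/
noncomputable def TS.fpow (x α : ℝ) : ℝ := Real.sign x * |x| ^ α

/-- `α` is of the form `1/q` for some odd natural number `q`. -/
def TS.OddRecip (α : ℝ) : Prop := ∃ q : ℕ, Odd q ∧ α = 1 / (q : ℝ)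

/-- `L` is the nabla fractional derivative of `f` of order `α` at `t` on the
time scale `T`.  If `α = 1/q` with `q` odd, a full `δ`-neighborhood of `t` in
`T` is used; otherwise only the right `δ`-neighborhood `[t, t+δ[ ∩ T`. -/
def TS.HasNablaFracDerivAt (T : Set ℝ) (f : ℝ → ℝ) (α t L : ℝ) : Prop :=
  (TS.OddRecip α → ∀ ε > (0:ℝ), ∃ δ > (0:ℝ), ∀ s ∈ T, |s - t| < δ →
      |(f s - f (TS.rho T t)) - L * TS.fpow (s - TS.rho T t) α|
        ≤ ε * |s - TS.rho T t| ^ α) ∧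
  (¬ TS.OddRecip α → ∀ ε > (0:ℝ), ∃ δ > (0:ℝ), ∀ s ∈ T, t ≤ s → s < t + δ →
      |(f s - f (TS.rho T t)) - L * TS.fpow (s - TS.rho T t) α|
        ≤ ε * |s - TS.rho T t| ^ α)

/-- `L` is a symmetric fractional derivative of `f` of order `α` at `t` on the
time scale `T`. -/
def TS.HasSymFracDerivAt (T : Set ℝ) (f : ℝ → ℝ) (α t L : ℝ) : Prop :=
  ∀ ε > (0:ℝ), ∃ δ > (0:ℝ), ∀ s ∈ T, |s - t| < δ →
    2 * t - s ∈ T → |(2 * t - s) - t| < δ →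
      |(f (TS.sigma T t) - f s + f (2 * t - s) - f (TS.rho T t))
          - L * TS.fpow (TS.sigma T t + 2 * t - 2 * s - TS.rho T t) α|
        ≤ ε * |TS.sigma T t + 2 * t - 2 * s - TS.rho T t| ^ α

theorem aux_quot (l : Filter ℝ) (f g φ p : ℝ → ℝ) (t r F G : ℝ)
    (hfc : Tendsto f l (𝓝 (f t))) (hgc : Tendsto g l (𝓝 (g t)))
    (hp : ∀ s, |φ s| ≤ p s)
    (hf : ∀ ε > (0:ℝ), ∀ᶠ s in l, |(f s - f r) - F * φ s| ≤ ε * p s)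
    (hg : ∀ ε > (0:ℝ), ∀ᶠ s in l, |(g s - g r) - G * φ s| ≤ ε * p s)
    (hne : g r * g t ≠ 0) :
    ∀ ε > (0:ℝ), ∀ᶠ s in l, |(f s / g s - f r / g r) -
      ((F * g t - f t * G) / (g r * g t)) * φ s| ≤ ε * p s := by
  intro ε hε
  have hr : g r ≠ 0 := left_ne_zero_of_mul hne
  have ht : g t ≠ 0 := right_ne_zero_of_mul hne
  have h1 : Tendsto (fun s => (F * g s - f s * G) / (g r * g s)) l
      (𝓝 ((F * g t - f t * G) / (g r * g t))) :=
    ((hgc.const_mul F).sub (hfc.mul_const G)).div (hgc.const_mul _) hne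
  have h2 : Tendsto (fun s => |1 / g r|  + |f s / (g r * g s)|) l
      (𝓝 (|1 / g r| + |f t / (g r * g t)|)) :=
    tendsto_const_nhds.add (hfc.div (hgc.const_mul _) hne).abs
  obtain ⟨K, hK⟩ : ∃ K, K = |1 / g r| + |f t / (g r * g t)| + 1 := ⟨_, rfl⟩
  have hK0 : 0 < K := by rw [hK]; positivity
  have hε' : 0 < ε / (2 * K) := by positivity
  have e2 := h2.eventually (gt_mem_nhds (show _ < K by rw [hK]; linarith))
  have e1 := h1.eventually (Metric.ball_mem_nhds _ (half_pos hε))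
  filter_upwards [e1, e2, hf _ hε', hg _ hε', hgc.eventually_ne ht] with s a1 a2 a3 a4 a5
  rw [Real.dist_eq] at a1
  have hp0 : 0 ≤ p s := (abs_nonneg _).trans (hp s)
  have key : (f s / g s - f r / g r) - ((F * g t - f t * G) / (g r * g t)) * φ s
      = ((F * g s - f s * G) / (g r * g s) - (F * g t - f t * G) / (g r * g t)) * φ s
        + ((1 / g r) * ((f s - f r) - F * φ s)
          - (f s / (g r * g s)) * ((g s - g r) - G * φ s)) := by
    field_simp
    ring
  rw [key]
  have b1 : |((F * g s - f s * G) / (g r * g s) - (F * g t - f t * G) / (g r * g t)) * φ s|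
      ≤ ε / 2 * p s := by
    rw [abs_mul]
    exact mul_le_mul a1.le (hp s) (abs_nonneg _) (by positivity)
  have b2 : |(1 / g r) * ((f s - f r) - F * φ s)| ≤ |1 / g r| * (ε / (2 * K) * p s) := by
    rw [abs_mul]
    exact mul_le_mul_of_nonneg_left a3 (abs_nonneg _)
  have b3 : |(f s / (g r * g s)) * ((g s - g r) - G * φ s)|
      ≤ |f s / (g r * g s)| * (ε / (2 * K) * p s) := by
    rw [abs_mul]
    exact mul_le_mul_of_nonneg_left a4 (abs_nonneg _)
  have b4 : (|1 / g r| + |f s / (g r * g s)|) * (ε / (2 * K) * p s)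
      ≤ K * (ε / (2 * K) * p s) :=
    mul_le_mul_of_nonneg_right a2.le (by positivity)
  have b5 : K * (ε / (2 * K) * p s) = ε / 2 * p s := by
    field_simp
  have c1 := abs_add_le (((F * g s - f s * G) / (g r * g s)
    - (F * g t - f t * G) / (g r * g t)) * φ s) ((1 / g r) * ((f s - f r) - F * φ s)
          - (f s / (g r * g s)) * ((g s - g r) - G * φ s))
  have c2 := abs_sub ((1 / g r) * ((f s - f r) - F * φ s))
    ((f s / (g r * g s)) * ((g s - g r) - G * φ s))
  linarith

theorem aux_full (T : Set ℝ) (t : ℝ) (P : ℝ → Prop) :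
    (∃ δ > (0:ℝ), ∀ s ∈ T, |s - t| < δ → P s) ↔ ∀ᶠ s in 𝓝[T] t, P s := by
  rw [eventually_nhdsWithin_iff, Metric.eventually_nhds_iff]
  simp only [Real.dist_eq]
  constructor
  · rintro ⟨δ, h, H⟩
    exact ⟨δ, h, fun s a b => H s b a⟩
  · rintro ⟨δ, h, H⟩
    exact ⟨δ, h, fun s a b => H b a⟩

theorem aux_right (T : Set ℝ) (t : ℝ) (P : ℝ → Prop) :
    (∃ δ > (0:ℝ), ∀ s ∈ T, t ≤ s → s < t + δ → P s) ↔ ∀ᶠ s in 𝓝[T ∩ Ici t] t, P s := by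
  rw [← aux_full]
  constructor
  · rintro ⟨δ, h, H⟩
    exact ⟨δ, h, fun s a b => H s a.1 a.2 (by linarith [(abs_lt.1 b).2])⟩
  · rintro ⟨δ, h, H⟩
    refine ⟨δ, h, fun s a b c => H s ⟨a, b⟩ ?_⟩
    rw [abs_lt]
    constructor <;> linarith

theorem aux_fpow (x α : ℝ) : |TS.fpow x α| ≤ |x| ^ α := by
  have h : 0 ≤ |x| ^ α := Real.rpow_nonneg (abs_nonneg _) _
  unfold TS.fpow
  rw [abs_mul, abs_of_nonneg h]
  refine mul_le_of_le_one_left h ?_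
  rcases Real.sign_apply_eq x with h | h | h <;> rw [h] <;> norm_num

/-- Quotient rule for the nabla fractional derivative. -/
theorem stmt15 (T : Set ℝ) (hTne : T.Nonempty) (hTcl : IsClosed T)
    (f g : ℝ → ℝ) (t : ℝ) (ht : t ∈ TS.kappaLow T)
    (α : ℝ) (hα : α ∈ Set.Ioc (0:ℝ) 1) (F G : ℝ)
    (hfc : ContinuousOn f T) (hgc : ContinuousOn g T)
    (hf : TS.HasNablaFracDerivAt T f α t F)
    (hg : TS.HasNablaFracDerivAt T g α t G)
    (hne : g (TS.rho T t) * g t ≠ 0) :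
    TS.HasNablaFracDerivAt T (fun s => f s / g s) α t
      ((F * g t - f t * G) / (g (TS.rho T t) * g t)) := by
  have htT : t ∈ T := ht.1
  unfold TS.HasNablaFracDerivAt at *
  simp only [aux_full, aux_right] at *
  refine ⟨fun ho => ?_, fun ho => ?_⟩
  · exact aux_quot (𝓝[T] t) f g (fun s => TS.fpow (s - TS.rho T t) α)
      (fun s => |s - TS.rho T t| ^ α) t (TS.rho T t) F G (hfc t htT) (hgc t htT)
      (fun s => aux_fpow _ _) (hf.1 ho) (hg.1 ho) hne
  · exact aux_quot (𝓝[T ∩ Ici t] t) f g (fun s => TS.fpow (s - TS.rho T t) α)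
      (fun s => |s - TS.rho T t| ^ α) t (TS.rho T t) F G
      ((hfc t htT).mono_left (nhdsWithin_mono _ inter_subset_left))
      ((hgc t htT).mono_left (nhdsWithin_mono _ inter_subset_left))
      (fun s => aux_fpow _ _) (hf.2 ho) (hg.2 ho) hne
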